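/- arXiv:0708.3441 — 6 statements merged into one kernel-verified Lean document; each statement's English description precedes it below -/
import Mathlib

section
/- Let G be a rooted acyclic oriented graph with vertex set V. Then the function x ↦ ℰ_G(x) on [0,1] agrees with a polynomial of degree at most |V| − 1. -/
open MeasureTheory

structure OGraph where
  V : Type
  fin : Fintype V
  deq : DecidableEq V
  E : V → V → Prop
  root : V

attribute [instance] OGraph.fin OGraph.deq

namespace OGraph

/-- `a ≺ b`: there is a directed path from `b` to `a`. -/
def prec (G : OGraph) (a b : G.V) : Prop := Relation.TransGen G.E b a

def Acyclic (G : OGraph) : Prop := ∀ a : G.V, ¬ G.prec a a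

/-- `ℰ_G(x)`: the volume of the set `Z_G(x)` of compatible functions with value `x` at the root,
viewed as a subset of the cube indexed by non-root vertices. -/
noncomputable def vol (G : OGraph) (x : ℝ) : ℝ :=
  (volume {f : {v : G.V // v ≠ G.root} → ℝ |
    (∀ v, f v ∈ Set.Icc (0:ℝ) 1) ∧
    ∀ a b : G.V, G.prec a b →
      (if ha : a = G.root then x else f ⟨a, ha⟩) <
      (if hb : b = G.root then x else f ⟨b, hb⟩)}).toReal

/-- The `(n,m)`-chain. -/
def chain (n m : ℕ) : OGraph where
  V := Fin (n + m + 1)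
  fin := inferInstance
  deq := inferInstance
  E := fun i j => (i : ℕ) = (j : ℕ) + 1
  root := ⟨n, by omega⟩

end OGraph


namespace OGraph

/-- extension of `f` by the value `x` at the root -/
noncomputable def extv (G : OGraph) (x : ℝ) (f : {v : G.V // v ≠ G.root} → ℝ) (a : G.V) : ℝ :=
  if ha : a = G.root then x else f ⟨a, ha⟩

/-- the compatible functions -/
def Z (G : OGraph) (x : ℝ) : Set ({v : G.V // v ≠ G.root} → ℝ) :=
  {f | (∀ v, f v ∈ Set.Icc (0:ℝ) 1) ∧ ∀ a b : G.V, G.prec a b → G.extv x f a < G.extv x f b}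

/-- the sign conditions given by `S` -/
def sgn (G : OGraph) (S : Finset {v : G.V // v ≠ G.root}) (x : ℝ) :
    Set ({v : G.V // v ≠ G.root} → ℝ) :=
  {f | ∀ v, if v ∈ S then f v < x else x < f v}

theorem meas_Z (G : OGraph) (x : ℝ) : MeasurableSet (G.Z x) := by
  have he : ∀ a, Measurable (fun f => G.extv x f a) := by
    intro a
    unfold extv
    split_ifs
    · exact measurable_const
    · exact measurable_pi_apply _
  have : G.Z x = (⋂ v, {f | f v ∈ Set.Icc (0:ℝ) 1}) ∩
      ⋂ a, ⋂ b, ⋂ (_ : G.prec a b), {f | G.extv x f a < G.extv x f b} := by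
    ext f; simp [Z]
  rw [this]
  refine MeasurableSet.inter (MeasurableSet.iInter fun v => ?_) ?_
  · exact measurable_pi_apply v measurableSet_Icc
  · exact MeasurableSet.iInter fun a => MeasurableSet.iInter fun b => MeasurableSet.iInter fun _ =>
      measurableSet_lt (he a) (he b)

theorem meas_sgn (G : OGraph) (S) (x : ℝ) : MeasurableSet (G.sgn S x) := by
  have : G.sgn S x = ⋂ v, {f | if v ∈ S then f v < x else x < f v} := by
    ext f; simp [sgn]
  rw [this]
  refine MeasurableSet.iInter fun v => ?_
  split_ifs
  · exact measurableSet_lt (measurable_pi_apply v) measurable_const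
  · exact measurableSet_lt measurable_const (measurable_pi_apply v)

theorem Z_finite (G : OGraph) (x : ℝ) : volume (G.Z x) ≠ ⊤ := by
  have : G.Z x ⊆ Set.Icc 0 1 := fun f hf => ⟨fun v => (hf.1 v).1, fun v => (hf.1 v).2⟩
  exact ((measure_mono this).trans_lt (isCompact_Icc.measure_lt_top)).ne

theorem vol_eq_sum (G : OGraph) (x : ℝ) :
    G.vol x = ∑ S : Finset {v : G.V // v ≠ G.root}, (volume (G.Z x ∩ G.sgn S x)).toReal := by
  have h1 : G.vol x = (volume (G.Z x)).toReal := rfl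
  have hne : ∀ᵐ f : {v : G.V // v ≠ G.root} → ℝ, ∀ v, f v ≠ x := by
    rw [ae_all_iff]
    intro v
    have := Measure.pi_hyperplane (fun _ : {v : G.V // v ≠ G.root} => (volume : Measure ℝ)) v x
    rw [ae_iff]
    simpa [volume_pi] using this
  have h2 : volume (G.Z x) = volume (⋃ S ∈ (Finset.univ : Finset (Finset {v : G.V // v ≠ G.root})),
      G.Z x ∩ G.sgn S x) := by
    apply measure_congr
    filter_upwards [hne] with f hf
    apply propext
    change f ∈ G.Z x ↔ f ∈ (⋃ S ∈ (Finset.univ : Finset (Finset {v : G.V // v ≠ G.root})),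
      G.Z x ∩ G.sgn S x)
    simp only [Finset.mem_univ, Set.iUnion_true, Set.mem_iUnion, Set.mem_inter_iff]
    constructor
    · intro h
      refine ⟨Finset.univ.filter (fun v => f v < x), h, ?_⟩
      intro v
      by_cases hv : f v < x
      · simp [hv]
      · simpa [hv] using lt_of_le_of_ne (not_lt.1 hv) (hf v).symm
    · rintro ⟨S, h, _⟩; exact h
  rw [h1, h2, measure_biUnion_finset, ENNReal.toReal_sum]
  · intro S _
    exact ne_top_of_le_ne_top (G.Z_finite x) (measure_mono Set.inter_subset_left)
  · intro S _ T _ hST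
    rw [Function.onFun, Set.disjoint_left]
    rintro f ⟨_, hS⟩ ⟨_, hT⟩
    apply hST
    ext v
    have a := hS v
    have b := hT v
    split_ifs at a b <;> first | (exfalso; linarith) | simp [*]
  · intro S _
    exact (G.meas_Z x).inter (G.meas_sgn S x)

/-- the scaling factors -/
noncomputable def D (G : OGraph) (S : Finset {v : G.V // v ≠ G.root}) (x : ℝ)
    (v : {v : G.V // v ≠ G.root}) : ℝ := if v ∈ S then 2 * x else 2 * (1 - x)

/-- the translation -/
noncomputable def tr (G : OGraph) (S : Finset {v : G.V // v ≠ G.root}) (x : ℝ)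
    (v : {v : G.V // v ≠ G.root}) : ℝ := if v ∈ S then 0 else 2 * x - 1

theorem mem_iff (G : OGraph) (S : Finset {v : G.V // v ≠ G.root}) (x : ℝ)
    (hx : x ∈ Set.Icc (0:ℝ) 1) (hD : ∀ v, 0 < G.D S x v) (f : {v : G.V // v ≠ G.root} → ℝ) :
    (fun v => G.D S x v * f v + G.tr S x v) ∈ G.Z x ∩ G.sgn S x ↔
      f ∈ G.Z (1/2) ∩ G.sgn S (1/2) := by
  have hs : (fun v => G.D S x v * f v + G.tr S x v) ∈ G.sgn S x ↔ f ∈ G.sgn S (1/2) := by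
    unfold sgn
    refine forall_congr' fun v => ?_
    have := hD v
    unfold D at this
    simp only [D, tr]
    split_ifs with hv <;> simp only [hv, if_true, if_false] at this <;>
      constructor <;> intro h <;> nlinarith
  rw [Set.mem_inter_iff, Set.mem_inter_iff, hs, and_congr_left_iff]
  intro hf
  unfold Z
  refine and_congr (forall_congr' fun v => ?_) ?_
  · have := hD v
    have h2 := hf v
    unfold D at this
    simp only [D, tr, Set.mem_Icc]
    split_ifs at this h2 ⊢ with hv
    · constructor
      · rintro ⟨h3, h4⟩; constructor <;> nlinarith
      · rintro ⟨h3, h4⟩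
        have : x ≤ 1 := by linarith [hx.1, hx.2]
        constructor <;> nlinarith
    · constructor
      · rintro ⟨h3, h4⟩; constructor <;> nlinarith
      · rintro ⟨h3, h4⟩
        have : 0 ≤ x := by linarith [hx.1, hx.2]
        constructor <;> nlinarith
  · refine forall_congr' fun a => forall_congr' fun b => imp_congr_right fun _ => ?_
    unfold extv
    by_cases ha : a = G.root <;> by_cases hb : b = G.root
    · simp [ha, hb]
    · have := hD ⟨b, hb⟩
      have h2 := hf ⟨b, hb⟩
      unfold D at this
      simp only [ha, hb, dite_true, dite_false, D, tr]
      split_ifs at this h2 ⊢ <;> constructor <;> intro h <;> nlinarith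
    · have := hD ⟨a, ha⟩
      have h2 := hf ⟨a, ha⟩
      unfold D at this
      simp only [ha, hb, dite_true, dite_false, D, tr]
      split_ifs at this h2 ⊢ <;> constructor <;> intro h <;> nlinarith
    · have h1 := hD ⟨a, ha⟩
      have h2 := hf ⟨a, ha⟩
      have h3 := hD ⟨b, hb⟩
      have h4 := hf ⟨b, hb⟩
      unfold D at h1 h3
      simp only [ha, hb, dite_false, D, tr]
      split_ifs at h1 h2 h3 h4 ⊢ <;> constructor <;> intro h <;> nlinarith

theorem piece (G : OGraph) (S : Finset {v : G.V // v ≠ G.root}) (x : ℝ) (hx : x ∈ Set.Icc (0:ℝ) 1) :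
    (volume (G.Z x ∩ G.sgn S x)).toReal =
      (∏ v, G.D S x v) * (volume (G.Z (1/2) ∩ G.sgn S (1/2))).toReal := by
  have hD0 : ∀ v, 0 ≤ G.D S x v := by
    intro v; unfold D; split_ifs <;> linarith [hx.1, hx.2]
  by_cases hD : ∀ v, 0 < G.D S x v
  · have key : G.Z (1/2) ∩ G.sgn S (1/2) = (Matrix.toLin' (Matrix.diagonal (G.D S x))) ⁻¹'
        ((fun f => f + G.tr S x) ⁻¹' (G.Z x ∩ G.sgn S x)) := by
      ext f
      rw [← G.mem_iff S x hx hD f]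
      simp only [Set.mem_preimage, Matrix.toLin'_apply]
      congr! 1
      ext v
      simp [Matrix.mulVec_diagonal]
    have hpos : 0 < ∏ v, G.D S x v := Finset.prod_pos fun v _ => hD v
    have hdet : LinearMap.det (Matrix.toLin' (Matrix.diagonal (G.D S x))) = ∏ v, G.D S x v := by
      rw [LinearMap.det_toLin', Matrix.det_diagonal]
    rw [key, Measure.addHaar_preimage_linearMap _ (by rw [hdet]; exact hpos.ne'), hdet,
      measure_preimage_add_right, ENNReal.toReal_mul, ENNReal.toReal_ofReal (abs_nonneg _),
      abs_of_pos (inv_pos.2 hpos), mul_inv_cancel_left₀ hpos.ne']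
  · push Not at hD
    obtain ⟨v, hv⟩ := hD
    have hv0 := le_antisymm hv (hD0 v)
    rw [Finset.prod_eq_zero (Finset.mem_univ v) hv0, zero_mul]
    have : G.Z x ∩ G.sgn S x = ∅ := by
      ext f
      simp only [Set.mem_inter_iff, Set.mem_empty_iff_false, iff_false, not_and]
      intro h1 h2
      have a := h1.1 v
      have b := h2 v
      unfold D at hv0
      split_ifs at b hv0 <;> linarith [a.1, a.2]
    simp [this]

end OGraph

/-- `ℰ_G` agrees on `[0,1]` with a polynomial of degree at most `|V| - 1`. -/
theorem vol_is_polynomial (G : OGraph) (h : G.Acyclic) :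
    ∃ p : Polynomial ℝ, p.natDegree ≤ Fintype.card G.V - 1 ∧
      ∀ x ∈ Set.Icc (0:ℝ) 1, G.vol x = p.eval x := by
  refine ⟨∑ S : Finset {v : G.V // v ≠ G.root},
    (∏ v, if v ∈ S then Polynomial.C 2 * Polynomial.X
      else Polynomial.C 2 * (1 - Polynomial.X)) *
      Polynomial.C (volume (G.Z (1/2) ∩ G.sgn S (1/2))).toReal, ?_, ?_⟩
  · apply Polynomial.natDegree_sum_le_of_forall_le
    intro S _
    refine (Polynomial.natDegree_mul_C_le _ _).trans ?_
    refine (Polynomial.natDegree_prod_le _ _).trans ?_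
    have hc : Fintype.card {v : G.V // v ≠ G.root} = Fintype.card G.V - 1 := by
      simp
    rw [← hc, ← Finset.card_univ, Finset.card_eq_sum_ones]
    refine Finset.sum_le_sum fun v _ => ?_
    split_ifs <;> compute_degree
  · intro x hx
    rw [G.vol_eq_sum, Polynomial.eval_finsetSum]
    refine Finset.sum_congr rfl fun S _ => ?_
    rw [G.piece S x hx, Polynomial.eval_mul, Polynomial.eval_C, Polynomial.eval_prod]
    congr 1
    refine Finset.prod_congr rfl fun v _ => ?_
    unfold OGraph.D
    split_ifs <;> simp
end

section
/- Let G be a rooted acyclic oriented graph. Then for every x in the open interval (0,1), ℰ_{(d/dx)G}(x) = (d/dx) ℰ_G(x), where the right-hand side is the ordinary derivative of the polynomial function ℰ_G. -/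
open MeasureTheory

namespace OGraph

/-- The graph `G` with the edge joining the root and `v` contracted
(`v` is merged into the root). -/
def contract (G : OGraph) (v : G.V) : OGraph where
  V := {u : G.V // u = G.root ∨ u ≠ v}
  fin := inferInstance
  deq := inferInstance
  E := fun a b => a.val ≠ b.val ∧
    (G.E a.val b.val ∨ (G.E a.val v ∧ b.val = G.root) ∨ (G.E v b.val ∧ a.val = G.root))
  root := ⟨G.root, Or.inl rfl⟩

end OGraph

namespace OGraph

/-- Extension of a function on non-root vertices by the value `t` at the root. -/
noncomputable def extd (H : OGraph) (t : ℝ) (f : {v : H.V // v ≠ H.root} → ℝ) (a : H.V) : ℝ :=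
  if ha : a = H.root then t else f ⟨a, ha⟩

/-- The set of compatible functions. -/
def Zset (H : OGraph) (t : ℝ) : Set ({v : H.V // v ≠ H.root} → ℝ) :=
  {f | (∀ v, f v ∈ Set.Icc (0:ℝ) 1) ∧ ∀ a b : H.V, H.prec a b → H.extd t f a < H.extd t f b}

theorem vol_eq (H : OGraph) (t : ℝ) : H.vol t = (volume (H.Zset t)).toReal := rfl

theorem extd_root (H : OGraph) (t : ℝ) (f) : H.extd t f H.root = t := by simp [extd]

theorem extd_ne (H : OGraph) (t : ℝ) (f) (a : H.V) (ha : a ≠ H.root) :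
    H.extd t f a = f ⟨a, ha⟩ := by simp [extd, ha]

theorem extd_measurable (H : OGraph) (a : H.V) :
    Measurable (fun p : ({v : H.V // v ≠ H.root} → ℝ) × ℝ => H.extd p.2 p.1 a) := by
  unfold extd
  split_ifs with ha
  · exact measurable_snd
  · exact (measurable_pi_apply _).comp measurable_fst

theorem Zset_prod_measurable (H : OGraph) :
    MeasurableSet {p : ({v : H.V // v ≠ H.root} → ℝ) × ℝ | p.1 ∈ H.Zset p.2} := by
  have : {p : ({v : H.V // v ≠ H.root} → ℝ) × ℝ | p.1 ∈ H.Zset p.2} =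
      (⋂ v, {p | p.1 v ∈ Set.Icc (0:ℝ) 1}) ∩
      ⋂ a, ⋂ b, ⋂ (_ : H.prec a b), {p | H.extd p.2 p.1 a < H.extd p.2 p.1 b} := by
    ext p; simp [Zset]
  rw [this]
  refine MeasurableSet.inter (MeasurableSet.iInter fun v => ?_)
    (MeasurableSet.iInter fun a => MeasurableSet.iInter fun b => MeasurableSet.iInter fun _ => ?_)
  · exact ((measurable_pi_apply v).comp measurable_fst) measurableSet_Icc
  · exact measurableSet_lt (H.extd_measurable a) (H.extd_measurable b)

theorem Zset_measurable (H : OGraph) (t : ℝ) : MeasurableSet (H.Zset t) := by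
  have : Measurable (fun f : {v : H.V // v ≠ H.root} → ℝ => (f, t)) := by fun_prop
  exact this H.Zset_prod_measurable

theorem Zset_sub (H : OGraph) (t : ℝ) : H.Zset t ⊆ Set.univ.pi fun _ => Set.Icc (0:ℝ) 1 :=
  fun _ hf v _ => hf.1 v

theorem cube_vol (ι : Type) [Fintype ι] :
    volume (Set.univ.pi fun _ : ι => Set.Icc (0:ℝ) 1) = 1 := by
  rw [volume_pi_pi]; simp

theorem Zset_finite (H : OGraph) (t : ℝ) : volume (H.Zset t) ≠ ⊤ := by
  refine ne_top_of_le_ne_top ?_ (measure_mono (H.Zset_sub t))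
  rw [cube_vol]; simp

theorem vol_integral (H : OGraph) (t : ℝ) :
    H.vol t = ∫ f, (H.Zset t).indicator (fun _ => (1:ℝ)) f := by
  rw [integral_indicator (H.Zset_measurable t)]
  simp [vol_eq, Measure.real]

theorem ae_ne (ι : Type) [Fintype ι] (x : ℝ) : ∀ᵐ f : ι → ℝ, ∀ v, f v ≠ x := by
  rw [ae_all_iff]; intro v
  exact Measure.ae_eval_ne (fun _ : ι => (volume : Measure ℝ)) v x

theorem ae_inj (ι : Type) [Fintype ι] : ∀ᵐ f : ι → ℝ, Function.Injective f := by
  classical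
  have : ∀ᵐ f : ι → ℝ, ∀ u v, u ≠ v → f u ≠ f v := by
    rw [ae_all_iff]; intro u
    rw [ae_all_iff]; intro v
    by_cases huv : u = v
    · simp [huv]
    have hz := Measure.addHaar_submodule (volume : Measure (ι → ℝ))
      (LinearMap.ker (LinearMap.proj (R := ℝ) (φ := fun _ : ι => ℝ) u - LinearMap.proj v)) (by
        intro h
        have h1 : (Pi.single u 1 : ι → ℝ) ∈ (⊤ : Submodule ℝ (ι → ℝ)) := trivial
        rw [← h] at h1
        simp [LinearMap.mem_ker, Pi.single_apply, Ne.symm huv] at h1)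
    rw [ae_iff]
    refine measure_mono_null ?_ hz
    intro f hf
    simp only [ne_eq, Set.mem_ofPred_eq, huv, not_false_eq_true, forall_const, not_not] at hf
    simp [LinearMap.mem_ker, hf]
  filter_upwards [this] with f hf u v h
  by_contra h'
  exact hf u v h' h

theorem vol_continuous (H : OGraph) : Continuous H.vol := by
  rw [continuous_iff_continuousAt]
  intro x
  have : H.vol = fun t => ∫ f, (H.Zset t).indicator (fun _ => (1:ℝ)) f := funext H.vol_integral
  rw [this]
  refine continuousAt_of_dominated
    (bound := (Set.univ.pi fun _ => Set.Icc (0:ℝ) 1).indicator fun _ => (1:ℝ)) ?_ ?_ ?_ ?_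
  · exact Filter.Eventually.of_forall fun t =>
      (measurable_const.indicator (H.Zset_measurable t)).aestronglyMeasurable
  · refine Filter.Eventually.of_forall fun t => Filter.Eventually.of_forall fun f => ?_
    rw [norm_indicator_eq_indicator_norm]
    simp only [norm_one]
    exact Set.indicator_le_indicator_of_subset (H.Zset_sub t) (fun _ => zero_le_one) f
  · rw [integrable_indicator_iff (MeasurableSet.univ_pi fun _ => measurableSet_Icc)]
    rw [integrableOn_const_iff]
    right
    rw [cube_vol]; simp
  · filter_upwards [ae_ne _ x] with f hf
    have hev : ∀ᶠ t in nhds x, ∀ a b : H.V,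
        (H.extd t f a < H.extd t f b ↔ H.extd x f a < H.extd x f b) := by
      rw [Filter.eventually_all]; intro a
      rw [Filter.eventually_all]; intro b
      by_cases ha : a = H.root <;> by_cases hb : b = H.root
      · subst ha; simp [hb]
      · simp only [extd, ha, hb, dif_pos, dif_neg, not_false_eq_true]
        rcases lt_or_gt_of_ne (hf ⟨b, hb⟩) with h | h
        · filter_upwards [lt_mem_nhds h] with t ht
          exact iff_of_false ht.not_gt h.not_gt
        · filter_upwards [gt_mem_nhds h] with t ht
          simp [ht, h]
      · simp only [extd, ha, hb, dif_pos, dif_neg, not_false_eq_true]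
        rcases lt_or_gt_of_ne (hf ⟨a, ha⟩) with h | h
        · filter_upwards [lt_mem_nhds h] with t ht
          simp [ht, h]
        · filter_upwards [gt_mem_nhds h] with t ht
          exact iff_of_false ht.not_gt h.not_gt
      · simp [extd, ha, hb]
    have : (fun t => (H.Zset t).indicator (fun _ => (1:ℝ)) f) =ᶠ[nhds x]
        fun _ => (H.Zset x).indicator (fun _ => (1:ℝ)) f := by
      filter_upwards [hev] with t ht
      have : f ∈ H.Zset t ↔ f ∈ H.Zset x := by
        simp only [Zset, Set.mem_ofPred_eq, ht]
      by_cases h : f ∈ H.Zset x <;> simp [this, h]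
    exact continuousAt_const.congr this.symm

/-- Splitting off one coordinate preserves the volume. -/
theorem split_mp {M N : Type} [Fintype M] [Fintype N] (e : Option M ≃ N) :
    MeasurePreserving (fun f : N → ℝ => ((fun m => f (e (some m)), f (e none)) : (M → ℝ) × ℝ))
      volume volume := by
  have h1 := (volume_measurePreserving_piCongrLeft (fun _ : N => ℝ) e).symm
  have h2 : MeasurePreserving (MeasurableEquiv.piOptionEquivProd (fun _ : Option M => ℝ)).symm
      (volume : Measure ((M → ℝ) × ℝ)) (volume : Measure (Option M → ℝ)) :=
    ⟨MeasurableEquiv.measurable _,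
      Measure.pi_map_piOptionEquivProd (fun _ : Option M => (volume : Measure ℝ))⟩
  exact h2.symm.comp h1

theorem split_vol {M N : Type} [Fintype M] [Fintype N] (e : Option M ≃ N)
    (S : Set ((M → ℝ) × ℝ)) (hS : MeasurableSet S) :
    volume {f : N → ℝ | ((fun m => f (e (some m)), f (e none)) : (M → ℝ) × ℝ) ∈ S} =
      ∫⁻ t : ℝ, volume {g : M → ℝ | (g, t) ∈ S} := by
  have := (split_mp e).measure_preimage hS.nullMeasurableSet
  rw [Measure.volume_eq_prod, Measure.prod_apply_symm hS] at this
  exact this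

theorem prec_iff (H : OGraph) (g : H.V → ℝ) :
    (∀ a b, H.prec a b → g a < g b) ↔ ∀ a b, H.E b a → g a < g b := by
  constructor
  · intro h a b hab
    exact h a b (Relation.TransGen.single hab)
  · intro h a b hab
    induction hab with
    | single h1 => exact h _ _ h1
    | tail _ h1 ih => exact (h _ _ h1).trans ih

theorem bool_identity (Q AB Ox Oy Ix Iy : Prop) (e1 : Ox → Oy) (e2 : Iy → Ix)
    (e3x : Ox → Ix → AB) (e3y : Oy → Iy → AB) (e4 : AB → ¬ Ox → Ix) (e5 : AB → ¬ Iy → Oy)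
    [Decidable (Q ∧ Oy ∧ Iy)] [Decidable (Q ∧ Ox ∧ Ix)] [Decidable (Q ∧ AB ∧ Oy ∧ ¬ Ox)]
    [Decidable (Q ∧ AB ∧ Ix ∧ ¬ Iy)] :
    ((if Q ∧ Oy ∧ Iy then (1:ℝ) else 0) - if Q ∧ Ox ∧ Ix then 1 else 0) =
      (if Q ∧ AB ∧ Oy ∧ ¬ Ox then 1 else 0) - if Q ∧ AB ∧ Ix ∧ ¬ Iy then 1 else 0 := by
  by_cases c1 : Q <;> by_cases c2 : AB <;> by_cases c3 : Ox <;> by_cases c4 : Iy <;>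
    by_cases c5 : Oy <;> by_cases c6 : Ix <;> simp_all

/-- The combinatorial step identity. -/
theorem step_identity {N : Type} [Fintype N] (f : N → ℝ) (hf : Function.Injective f)
    (O I : N → Prop) (hOI : ∀ v, O v → ¬ I v) (Q : Prop) (x y : ℝ) (hxy : x < y)
    (hfx : ∀ v, f v ≠ x) (hfy : ∀ v, f v ≠ y) (P : ℝ → Prop) (T : N → Prop)
    (hP : ∀ t, P t ↔ Q ∧ (∀ u, O u → f u < t) ∧ (∀ u, I u → t < f u))
    (hT : ∀ v, O v ∨ I v → (T v ↔ f v ∈ Set.Ioo x y ∧ Q ∧ (∀ u, u ≠ v → O u → f u < f v) ∧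
      (∀ u, u ≠ v → I u → f v < f u))) [DecidablePred P] [DecidablePred T]
    [DecidablePred O] [DecidablePred I] :
    ((if P y then 1 else 0 : ℝ) - if P x then 1 else 0) =
      (∑ v, if O v then (if T v then (1:ℝ) else 0) else 0) -
      ∑ v, if I v then (if T v then (1:ℝ) else 0) else 0 := by
  classical
  have key : ∀ R : N → Prop, (∀ u v, R u → R v → T u → T v → u = v) →
      ∀ (_ : DecidablePred R),
      (∑ v, if R v then (if T v then (1:ℝ) else 0) else 0) =
        if ∃ v, R v ∧ T v then 1 else 0 := by
    intro R hR _
    split_ifs with h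
    · obtain ⟨v, hv, hv'⟩ := h
      rw [Finset.sum_eq_single v]
      · simp [hv, hv']
      · intro u _ huv
        by_cases h1 : R u <;> by_cases h2 : T u <;> simp [h1, h2]
        exact huv (hR _ _ h1 hv h2 hv')
      · simp
    · apply Finset.sum_eq_zero
      intro u _
      by_cases h1 : R u <;> by_cases h2 : T u <;> simp [h1, h2]
      exact h ⟨u, h1, h2⟩
  rw [key O ?_ _, key I ?_ _]
  · set AB : Prop := ∀ o i, O o → I i → f o < f i with hAB
    have ha : (∃ v, O v ∧ T v) ↔
        Q ∧ AB ∧ (∀ u, O u → f u < y) ∧ ¬ (∀ u, O u → f u < x) := by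
      constructor
      · rintro ⟨v, hv, hTv⟩
        obtain ⟨⟨h1, h2⟩, hQ, h3, h4⟩ := (hT v (Or.inl hv)).1 hTv
        have h5 : ∀ o, O o → f o ≤ f v := fun o ho => by
          by_cases h : o = v
          · rw [h]
          · exact (h3 o h ho).le
        refine ⟨hQ, ?_, ?_, ?_⟩
        · intro o i ho hi
          refine (h5 o ho).trans_lt (h4 i ?_ hi)
          rintro rfl; exact hOI _ hv hi
        · intro u hu; exact (h5 u hu).trans_lt h2
        · intro h; exact absurd (h v hv) (not_lt.2 h1.le)
      · rintro ⟨hQ, hab, h1, h2⟩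
        push Not at h2
        obtain ⟨w, hw, hwx⟩ := h2
        obtain ⟨v, hv, hmax⟩ := Finset.exists_max_image (Finset.univ.filter O) f
          ⟨w, by simp [hw]⟩
        simp only [Finset.mem_filter, Finset.mem_univ, true_and] at hv hmax
        refine ⟨v, hv, (hT v (Or.inl hv)).2 ⟨⟨?_, h1 v hv⟩, hQ, ?_, ?_⟩⟩
        · exact lt_of_le_of_ne (hwx.trans (hmax w hw)) (Ne.symm (hfx v))
        · intro u hu hOu
          exact lt_of_le_of_ne (hmax u hOu) fun h => hu (hf h)
        · intro u _ hIu; exact hab v u hv hIu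
    have hb : (∃ v, I v ∧ T v) ↔
        Q ∧ AB ∧ (∀ u, I u → x < f u) ∧ ¬ (∀ u, I u → y < f u) := by
      constructor
      · rintro ⟨v, hv, hTv⟩
        obtain ⟨⟨h1, h2⟩, hQ, h3, h4⟩ := (hT v (Or.inr hv)).1 hTv
        have h5 : ∀ o, I o → f v ≤ f o := fun o ho => by
          by_cases h : o = v
          · rw [h]
          · exact (h4 o h ho).le
        refine ⟨hQ, ?_, ?_, ?_⟩
        · intro o i ho hi
          refine (h3 o ?_ ho).trans_le (h5 i hi)
          rintro rfl; exact hOI _ ho hv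
        · intro u hu; exact h1.trans_le (h5 u hu)
        · intro h; exact absurd (h v hv) (not_lt.2 h2.le)
      · rintro ⟨hQ, hab, h1, h2⟩
        push Not at h2
        obtain ⟨w, hw, hwx⟩ := h2
        obtain ⟨v, hv, hmin⟩ := Finset.exists_min_image (Finset.univ.filter I) f
          ⟨w, by simp [hw]⟩
        simp only [Finset.mem_filter, Finset.mem_univ, true_and] at hv hmin
        refine ⟨v, hv, (hT v (Or.inr hv)).2 ⟨⟨h1 v hv, ?_⟩, hQ, ?_, ?_⟩⟩
        · exact lt_of_le_of_ne ((hmin w hw).trans hwx) (hfy v)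
        · intro u _ hOu; exact hab u v hOu hv
        · intro u hu hIu
          exact lt_of_le_of_ne (hmin u hIu) fun h => hu (hf h).symm
    simp only [ha, hb, hP]
    have e1 : (∀ u, O u → f u < x) → (∀ u, O u → f u < y) := fun h u hu => (h u hu).trans hxy
    have e2 : (∀ u, I u → y < f u) → (∀ u, I u → x < f u) := fun h u hu => hxy.trans (h u hu)
    have e3 : ∀ t, (∀ u, O u → f u < t) → (∀ u, I u → t < f u) → AB :=
      fun t h1 h2 o i ho hi => (h1 o ho).trans (h2 i hi)
    have e4 : AB → ¬ (∀ u, O u → f u < x) → (∀ u, I u → x < f u) := by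
      intro hab h u hu
      push Not at h
      obtain ⟨w, hw, hwx⟩ := h
      exact hwx.trans_lt (hab w u hw hu)
    have e5 : AB → ¬ (∀ u, I u → y < f u) → (∀ u, O u → f u < y) := by
      intro hab h u hu
      push Not at h
      obtain ⟨w, hw, hwx⟩ := h
      exact (hab u w hu hw).trans_le hwx
    have e3x := e3 x
    have e3y := e3 y
    exact bool_identity _ _ _ _ _ _ e1 e2 e3x e3y e4 e5
  · intro u v hu hv hTu hTv
    by_contra huv
    have h1 := ((hT u (Or.inr hu)).1 hTu).2.2.2 v (Ne.symm huv) hv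
    have h2 := ((hT v (Or.inr hv)).1 hTv).2.2.2 u huv hu
    exact lt_asymm h1 h2
  · intro u v hu hv hTu hTv
    by_contra huv
    have h1 := ((hT u (Or.inl hu)).1 hTu).2.2.1 v (Ne.symm huv) hv
    have h2 := ((hT v (Or.inl hv)).1 hTv).2.2.1 u huv hu
    exact lt_asymm h1 h2

theorem contract_val_ne (G : OGraph) (v : G.V)
    (m : {u : (G.contract v).V // u ≠ (G.contract v).root}) : m.1.1 ≠ G.root := by
  intro h
  exact m.2 (Subtype.ext h)

theorem contract_val_ne' (G : OGraph) (v : G.V)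
    (m : {u : (G.contract v).V // u ≠ (G.contract v).root}) : m.1.1 ≠ v := by
  rcases m.1.2 with h | h
  · exact absurd h (G.contract_val_ne v m)
  · exact h

/-- Non-root vertices of the contraction, together with `v`, are the non-root vertices of `G`. -/
def eqv (G : OGraph) (v : {u : G.V // u ≠ G.root}) :
    Option {u : (G.contract v.1).V // u ≠ (G.contract v.1).root} ≃ {u : G.V // u ≠ G.root} where
  toFun o := match o with
    | none => v
    | some m => ⟨m.1.1, G.contract_val_ne v.1 m⟩
  invFun u := if h : u.1 = v.1 then none else
    some ⟨⟨u.1, Or.inr h⟩, fun h' => u.2 (congrArg Subtype.val h')⟩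
  left_inv o := by
    rcases o with _ | m
    · simp
    · simp [G.contract_val_ne' v.1 m]
      exact Subtype.ext (Subtype.ext rfl)
  right_inv u := by
    by_cases h : u.1 = v.1
    · simp only [h, dif_pos]; exact (Subtype.ext h).symm
    · simp [h]

theorem extd_contract (G : OGraph) (v : {u : G.V // u ≠ G.root}) (t : ℝ)
    (f : {u : G.V // u ≠ G.root} → ℝ) (a : (G.contract v.1).V) :
    (G.contract v.1).extd t (fun m => f (G.eqv v (some m))) a = G.extd t f a.1 := by
  by_cases h : a.1 = G.root
  · have : a = (G.contract v.1).root := Subtype.ext h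
    rw [h, extd_root, this, extd_root]
  · have : a ≠ (G.contract v.1).root := fun h' => h (congrArg Subtype.val h')
    rw [extd_ne _ _ _ _ this, extd_ne _ _ _ _ h]
    rfl

/-- Conditions not involving the root. -/
def Base (G : OGraph) (f : {u : G.V // u ≠ G.root} → ℝ) : Prop :=
  (∀ v, f v ∈ Set.Icc (0:ℝ) 1) ∧ ∀ a b : {u : G.V // u ≠ G.root}, G.E b.1 a.1 → f a < f b

theorem noloop (G : OGraph) (h : G.Acyclic) (a : G.V) : ¬ G.E a a :=
  fun h' => h a (Relation.TransGen.single h')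

theorem notwo (G : OGraph) (h : G.Acyclic) (a b : G.V) (h1 : G.E a b) : ¬ G.E b a :=
  fun h' => h a (Relation.TransGen.tail (Relation.TransGen.single h1) h')

theorem mem_Zset_iff (G : OGraph) (h : G.Acyclic) (t : ℝ) (f : {u : G.V // u ≠ G.root} → ℝ) :
    f ∈ G.Zset t ↔ G.Base f ∧ (∀ u : {u : G.V // u ≠ G.root}, G.E G.root u.1 → f u < t) ∧
      (∀ u : {u : G.V // u ≠ G.root}, G.E u.1 G.root → t < f u) := by
  unfold Zset Base
  rw [Set.mem_ofPred_eq, prec_iff]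
  constructor
  · rintro ⟨h1, h2⟩
    refine ⟨⟨h1, fun a b hab => ?_⟩, fun u hu => ?_, fun u hu => ?_⟩
    · simpa [extd_ne _ _ _ _ a.2, extd_ne _ _ _ _ b.2] using h2 _ _ hab
    · simpa [extd_ne _ _ _ _ u.2, extd_root] using h2 _ _ hu
    · simpa [extd_ne _ _ _ _ u.2, extd_root] using h2 _ _ hu
  · rintro ⟨⟨h1, h2⟩, h3, h4⟩
    refine ⟨h1, fun a b hab => ?_⟩
    by_cases ha : a = G.root <;> by_cases hb : b = G.root
    · subst ha; subst hb; exact absurd hab (G.noloop h _)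
    · subst ha; rw [extd_root, extd_ne _ _ _ _ hb]; exact h4 ⟨b, hb⟩ hab
    · subst hb; rw [extd_root, extd_ne _ _ _ _ ha]; exact h3 ⟨a, ha⟩ hab
    · rw [extd_ne _ _ _ _ ha, extd_ne _ _ _ _ hb]; exact h2 ⟨a, ha⟩ ⟨b, hb⟩ hab

theorem mem_contract_iff (G : OGraph) (h : G.Acyclic) (v : {u : G.V // u ≠ G.root})
    (hv : G.E G.root v.1 ∨ G.E v.1 G.root) (f : {u : G.V // u ≠ G.root} → ℝ)
    (hfv : f v ∈ Set.Icc (0:ℝ) 1) :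
    (fun m => f (G.eqv v (some m))) ∈ (G.contract v.1).Zset (f v) ↔
      G.Base f ∧ (∀ u : {u : G.V // u ≠ G.root}, u ≠ v → G.E G.root u.1 → f u < f v) ∧
      (∀ u : {u : G.V // u ≠ G.root}, u ≠ v → G.E u.1 G.root → f v < f u) := by
  unfold Zset Base
  rw [Set.mem_ofPred_eq, prec_iff]
  simp only [extd_contract]
  constructor
  · rintro ⟨h1, h2⟩
    have lift : ∀ u : {u : G.V // u ≠ G.root}, u ≠ v → u.1 ≠ v.1 :=
      fun u hu h' => hu (Subtype.ext h')
    refine ⟨⟨fun u => ?_, fun a b hab => ?_⟩, fun u hu hE => ?_, fun u hu hE => ?_⟩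
    · by_cases hu : u = v
      · rw [hu]; exact hfv
      · exact h1 ⟨⟨u.1, Or.inr (lift u hu)⟩, fun h' => u.2 (congrArg Subtype.val h')⟩
    · by_cases ha : a = v <;> by_cases hb : b = v
      · subst ha; subst hb; exact absurd hab (G.noloop h _)
      · have := h2 (G.contract v.1).root ⟨b.1, Or.inr (lift b hb)⟩
          ⟨b.2, Or.inr (Or.inl ⟨ha ▸ hab, rfl⟩)⟩
        rw [ha]
        simpa [extd_ne _ _ _ _ b.2, contract, extd_root] using this
      · have := h2 ⟨a.1, Or.inr (lift a ha)⟩ (G.contract v.1).root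
          ⟨Ne.symm a.2, Or.inr (Or.inr ⟨hb ▸ hab, rfl⟩)⟩
        rw [hb]
        simpa [extd_ne _ _ _ _ a.2, contract, extd_root] using this
      · have := h2 ⟨a.1, Or.inr (lift a ha)⟩ ⟨b.1, Or.inr (lift b hb)⟩
          ⟨fun h' => G.noloop h a.1 (by have : b.1 = a.1 := h'; rw [this] at hab; exact hab),
            Or.inl hab⟩
        simpa [extd_ne _ _ _ _ a.2, extd_ne _ _ _ _ b.2] using this
    · have := h2 ⟨u.1, Or.inr (lift u hu)⟩ (G.contract v.1).root ⟨Ne.symm u.2, Or.inl hE⟩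
      simpa [extd_ne _ _ _ _ u.2, contract, extd_root] using this
    · have := h2 (G.contract v.1).root ⟨u.1, Or.inr (lift u hu)⟩ ⟨u.2, Or.inl hE⟩
      simpa [extd_ne _ _ _ _ u.2, contract, extd_root] using this
  · rintro ⟨⟨h1, h2⟩, h3, h4⟩
    refine ⟨fun m => h1 _, ?_⟩
    rintro ⟨a, ha'⟩ ⟨b, hb'⟩ hE
    obtain ⟨hne, hE⟩ := hE
    simp only at hne hE ⊢
    have nv : ∀ c (hc : c ≠ G.root), (c = G.root ∨ c ≠ v.1) →
        (⟨c, hc⟩ : {u : G.V // u ≠ G.root}) ≠ v := by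
      intro c hc hc' h'
      rcases hc' with h'' | h''
      · exact hc h''
      · exact h'' (congrArg Subtype.val h')
    by_cases ha : a = G.root <;> by_cases hb : b = G.root
    · exact absurd (hb.trans ha.symm) hne
    · rw [extd_ne _ _ _ _ hb]
      subst ha
      rw [extd_root]
      rcases hE with hE | ⟨hE, -⟩ | ⟨-, hE⟩
      · exact h4 ⟨b, hb⟩ (nv b hb hb') hE
      · exact h2 v ⟨b, hb⟩ hE
      · exact absurd hE hb
    · rw [extd_ne _ _ _ _ ha]
      subst hb
      rw [extd_root]
      rcases hE with hE | ⟨-, hE⟩ | ⟨hE, -⟩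
      · exact h3 ⟨a, ha⟩ (nv a ha ha') hE
      · exact absurd hE ha
      · exact h2 ⟨a, ha⟩ v hE
    · rw [extd_ne _ _ _ _ ha, extd_ne _ _ _ _ hb]
      rcases hE with hE | ⟨-, hE⟩ | ⟨-, hE⟩
      · exact h2 ⟨a, ha⟩ ⟨b, hb⟩ hE
      · exact absurd hE ha
      · exact absurd hE hb

/-- The slab set attached to `v`. -/
def Tset (G : OGraph) (x y : ℝ) (v : {u : G.V // u ≠ G.root}) :
    Set ({u : G.V // u ≠ G.root} → ℝ) :=
  {f | f v ∈ Set.Ioo x y ∧ (fun m => f (G.eqv v (some m))) ∈ (G.contract v.1).Zset (f v)}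

theorem Tset_prod_measurable (H : OGraph) (x y : ℝ) :
    MeasurableSet {p : ({v : H.V // v ≠ H.root} → ℝ) × ℝ | p.2 ∈ Set.Ioo x y ∧ p.1 ∈ H.Zset p.2} :=
  (measurable_snd measurableSet_Ioo).inter H.Zset_prod_measurable

theorem Tset_measurable (G : OGraph) (x y : ℝ) (v : {u : G.V // u ≠ G.root}) :
    MeasurableSet (G.Tset x y v) :=
  (split_mp (G.eqv v)).measurable (Tset_prod_measurable (G.contract v.1) x y)

theorem Tset_vol (G : OGraph) (x y : ℝ) (v : {u : G.V // u ≠ G.root}) :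
    volume (G.Tset x y v) = ∫⁻ t in Set.Ioo x y, ENNReal.ofReal ((G.contract v.1).vol t) := by
  have h := split_vol (G.eqv v) _ (Tset_prod_measurable (G.contract v.1) x y)
  have h0 : volume (G.Tset x y v) = _ := h
  rw [h0, ← lintegral_indicator measurableSet_Ioo]
  congr 1
  ext t
  by_cases ht : t ∈ Set.Ioo x y
  · rw [Set.indicator_of_mem ht, vol_eq, ENNReal.ofReal_toReal (Zset_finite _ _)]
    congr 1
    ext g
    exact ⟨fun h => h.2, fun h => ⟨ht, h⟩⟩
  · rw [Set.indicator_of_notMem ht]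
    have : {g | (g, t) ∈ {p : ({v_1 : (G.contract v.1).V // v_1 ≠ (G.contract v.1).root} → ℝ) × ℝ |
      p.2 ∈ Set.Ioo x y ∧ p.1 ∈ (G.contract v.1).Zset p.2}} = ∅ := by
      ext g
      exact ⟨fun h => ht h.1, fun h => h.elim⟩
    rw [this, measure_empty]

theorem vol_nonneg (H : OGraph) (t : ℝ) : 0 ≤ H.vol t := ENNReal.toReal_nonneg

theorem Tset_vol_toReal (G : OGraph) (x y : ℝ) (hxy : x ≤ y) (v : {u : G.V // u ≠ G.root}) :
    (volume (G.Tset x y v)).toReal = ∫ t in x..y, (G.contract v.1).vol t := by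
  rw [Tset_vol, intervalIntegral.integral_of_le hxy, integral_Ioc_eq_integral_Ioo,
    integral_eq_lintegral_of_nonneg_ae]
  · exact Filter.Eventually.of_forall fun t => vol_nonneg _ t
  · exact (vol_continuous _).aestronglyMeasurable

theorem Tset_finite (G : OGraph) (x y : ℝ) (v : {u : G.V // u ≠ G.root}) :
    volume (G.Tset x y v) ≠ ⊤ := by
  rw [Tset_vol]
  have h1 : IntegrableOn (G.contract v.1).vol (Set.Ioo x y) :=
    ((vol_continuous (G.contract v.1)).integrableOn_Icc (a := x) (b := y)).mono_set
      Set.Ioo_subset_Icc_self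
  have h2 := (hasFiniteIntegral_iff_ofReal
    (Filter.Eventually.of_forall fun t => vol_nonneg (G.contract v.1) t)).1 h1.2
  exact h2.ne

theorem integral_Tset (G : OGraph) (x y : ℝ) (hxy : x ≤ y) (v : {u : G.V // u ≠ G.root}) :
    ∫ f, (G.Tset x y v).indicator (fun _ => (1:ℝ)) f = ∫ t in x..y, (G.contract v.1).vol t := by
  rw [← Tset_vol_toReal _ _ _ hxy, integral_indicator (G.Tset_measurable x y v)]
  simp [Measure.real]

theorem integrable_Tset (G : OGraph) (x y : ℝ) (v : {u : G.V // u ≠ G.root}) :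
    Integrable ((G.Tset x y v).indicator (fun _ => (1:ℝ))) := by
  rw [integrable_indicator_iff (G.Tset_measurable x y v), integrableOn_const_iff]
  exact Or.inr (G.Tset_finite x y v).lt_top

theorem integrable_Zset (G : OGraph) (x : ℝ) :
    Integrable ((G.Zset x).indicator (fun _ => (1:ℝ))) := by
  rw [integrable_indicator_iff (G.Zset_measurable x), integrableOn_const_iff]
  exact Or.inr (G.Zset_finite x).lt_top

open Classical in
theorem vol_sub (G : OGraph) (h : G.Acyclic) (x y : ℝ) (hx : 0 < x) (hxy : x < y) (hy : y < 1) :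
    G.vol y - G.vol x =
      (∑ v : {u : G.V // u ≠ G.root},
        if G.E G.root v.1 then ∫ t in x..y, (G.contract v.1).vol t else 0) -
      ∑ v : {u : G.V // u ≠ G.root},
        if G.E v.1 G.root then ∫ t in x..y, (G.contract v.1).vol t else 0 := by
  have hint : ∀ (p : Prop) (v : {u : G.V // u ≠ G.root}),
      Integrable (fun f => if p then (G.Tset x y v).indicator (fun _ => (1:ℝ)) f else 0) := by
    intro p v
    by_cases hp : p
    · simpa [hp] using G.integrable_Tset x y v
    · simp [hp]
  have hval : ∀ (p : Prop) (v : {u : G.V // u ≠ G.root}),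
      (if p then ∫ t in x..y, (G.contract v.1).vol t else 0) =
      ∫ f, (if p then (G.Tset x y v).indicator (fun _ => (1:ℝ)) f else 0) := by
    intro p v
    by_cases hp : p
    · simp only [hp, if_true]; exact (G.integral_Tset x y hxy.le v).symm
    · simp [hp]
  simp only [hval]
  rw [vol_integral, vol_integral, ← integral_sub (G.integrable_Zset y) (G.integrable_Zset x),
    ← integral_finsetSum _ (fun v _ => hint _ v), ← integral_finsetSum _ (fun v _ => hint _ v),
    ← integral_sub (integrable_finsetSum _ fun v _ => hint _ v)
      (integrable_finsetSum _ fun v _ => hint _ v)]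
  refine integral_congr_ae ?_
  filter_upwards [ae_inj _, ae_ne _ x, ae_ne _ y] with f hf hfx hfy
  simp only [Set.indicator_apply]
  refine step_identity f hf (fun v => G.E G.root v.1) (fun v => G.E v.1 G.root)
    (fun v hv => G.notwo h _ _ hv) (G.Base f) x y hxy hfx hfy (fun t => f ∈ G.Zset t)
    (fun v => f ∈ G.Tset x y v) (fun t => G.mem_Zset_iff h t f) ?_
  intro v hv
  constructor
  · rintro ⟨h1, h2⟩
    exact ⟨h1, (G.mem_contract_iff h v hv f ⟨(hx.trans h1.1).le, (h1.2.trans hy).le⟩).1 h2⟩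
  · rintro ⟨h1, h2⟩
    exact ⟨h1, (G.mem_contract_iff h v hv f ⟨(hx.trans h1.1).le, (h1.2.trans hy).le⟩).2 h2⟩

open Classical in
/-- The volume of the formal derivative. -/
noncomputable def dvol (G : OGraph) (t : ℝ) : ℝ :=
  (∑ v : {u : G.V // u ≠ G.root}, if G.E G.root v.1 then (G.contract v.1).vol t else 0) -
    ∑ v : {u : G.V // u ≠ G.root}, if G.E v.1 G.root then (G.contract v.1).vol t else 0

theorem ite_continuous (p : Prop) [Decidable p] (H : OGraph) :
    Continuous fun t => if p then H.vol t else 0 := by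
  by_cases hp : p
  · simpa [hp] using H.vol_continuous
  · simpa [hp] using continuous_const

theorem dvol_continuous (G : OGraph) : Continuous G.dvol := by
  classical
  unfold dvol
  exact (continuous_finsetSum _ fun v _ => ite_continuous _ _).sub
    (continuous_finsetSum _ fun v _ => ite_continuous _ _)

theorem vol_sub' (G : OGraph) (h : G.Acyclic) (x y : ℝ) (hx : 0 < x) (hxy : x < y) (hy : y < 1) :
    G.vol y - G.vol x = ∫ t in x..y, G.dvol t := by
  classical
  rw [vol_sub G h x y hx hxy hy]
  unfold dvol
  rw [intervalIntegral.integral_sub, intervalIntegral.integral_finsetSum,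
    intervalIntegral.integral_finsetSum]
  · congr 1 <;> refine Finset.sum_congr rfl fun v _ => ?_ <;> split_ifs <;> simp
  · exact fun v _ => (ite_continuous _ _).intervalIntegrable _ _
  · exact fun v _ => (ite_continuous _ _).intervalIntegrable _ _
  · exact (continuous_finsetSum _ fun v _ => ite_continuous _ _).intervalIntegrable _ _
  · exact (continuous_finsetSum _ fun v _ => ite_continuous _ _).intervalIntegrable _ _

theorem vol_hasDerivAt (G : OGraph) (h : G.Acyclic) (x : ℝ) (hx : x ∈ Set.Ioo (0:ℝ) 1) :
    HasDerivAt G.vol (G.dvol x) x := by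
  have h1 : HasDerivAt (fun y => G.vol (x / 2) + ∫ t in (x / 2)..y, G.dvol t) (G.dvol x) x :=
    (intervalIntegral.integral_hasDerivAt_right (G.dvol_continuous.intervalIntegrable _ _)
      (G.dvol_continuous.stronglyMeasurableAtFilter _ _)
      G.dvol_continuous.continuousAt).const_add _
  refine h1.congr_of_eventuallyEq ?_
  have hx2 : x / 2 < x := by linarith [hx.1]
  filter_upwards [Ioo_mem_nhds hx2 hx.2] with y hy
  rw [← vol_sub' G h (x / 2) y (by linarith [hx.1]) hy.1 hy.2]
  ring

theorem sum_nonroot (G : OGraph) (p : G.V → Prop) (F : G.V → ℝ)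
    [DecidablePred p] [DecidablePred fun v => v ≠ G.root ∧ p v] :
    (∑ v : G.V, if v ≠ G.root ∧ p v then F v else 0) =
      ∑ v : {u : G.V // u ≠ G.root}, if p v.1 then F v.1 else 0 := by
  rw [← Finset.sum_subtype (Finset.univ.filter (· ≠ G.root)) (by simp)
    (fun v => if p v then F v else 0), Finset.sum_filter]
  refine Finset.sum_congr rfl fun v _ => ?_
  by_cases h1 : v = G.root <;> by_cases h2 : p v <;> simp [h1, h2]

end OGraph

open Classical in
/-- `ℰ_{(d/dx)G}(x) = (d/dx) ℰ_G(x)` for `x ∈ (0,1)`, where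
`(d/dx)G = Σ_e (-1)^e G_(e)`, the sum running over the edges incident to the root,
with sign `+1` for edges pointing away from the root and `-1` for edges pointing towards it. -/
theorem vol_graph_derivative (G : OGraph) (h : G.Acyclic) (x : ℝ) (hx : x ∈ Set.Ioo (0:ℝ) 1) :
    ((∑ v : G.V, if v ≠ G.root ∧ G.E G.root v then (G.contract v).vol x else 0) -
     (∑ v : G.V, if v ≠ G.root ∧ G.E v G.root then (G.contract v).vol x else 0))
      = deriv G.vol x := by
  rw [(G.vol_hasDerivAt h x hx).deriv]
  unfold OGraph.dvol
  rw [G.sum_nonroot (fun v => G.E G.root v) (fun v => (G.contract v).vol x),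
    G.sum_nonroot (fun v => G.E v G.root) (fun v => (G.contract v).vol x)]
end

section
/- (Leibniz rule) For every X₁, X₂ ∈ ℛ[r] and every a ∈ L, ∂/∂a (X₁ X₂) = (∂/∂a X₁) X₂ + X₁ (∂/∂a X₂). -/
/-- All shuffles (interleavings) of two lists. -/
def shuffles {α : Type*} : List α → List α → List (List α)
  | [], ys => [ys]
  | x :: xs, [] => [x :: xs]
  | x :: xs, y :: ys =>
      ((shuffles xs (y :: ys)).map (x :: ·)) ++ ((shuffles (x :: xs) ys).map (y :: ·))
  termination_by xs ys => xs.length + ys.length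

/-- `ℛ`: the free `ℤ`-module on finite sequences of labels. -/
abbrev CalcR (L : Type) := List L →₀ ℤ

/-- `ℛ[r]`: the free `ℤ`-module on the elements `A ⊗ B`, encoded as pairs of sequences. -/
abbrev CalcRr (L : Type) := (List L × List L) →₀ ℤ

/-- The shuffle product of two basis sequences. -/
noncomputable def shuffleBase {L : Type} (A B : List L) : CalcR L :=
  ((shuffles A B).map fun s => Finsupp.single s (1 : ℤ)).sum

/-- The shuffle product on `ℛ`. -/
noncomputable def rmul {L : Type} (X Y : CalcR L) : CalcR L :=
  X.sum fun A cA => Y.sum fun B cB => (cA * cB) • shuffleBase A B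

/-- The unit `∅` of `ℛ`. -/
noncomputable def rone (L : Type) : CalcR L := Finsupp.single [] 1

/-- The product `(A⊗B)(C⊗D) = (AC)⊗(BD)` of two basis elements of `ℛ[r]`. -/
noncomputable def pairBase {L : Type} (p q : List L × List L) : CalcRr L :=
  ((shuffles p.1 q.1).flatMap fun s =>
    (shuffles p.2 q.2).map fun t => Finsupp.single (s, t) (1 : ℤ)).sum

/-- The product on `ℛ[r]`. -/
noncomputable def pmul {L : Type} (X Y : CalcRr L) : CalcRr L :=
  X.sum fun p c => Y.sum fun q d => (c * d) • pairBase p q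

/-- The unit `∅ ⊗ ∅` of `ℛ[r]`. -/
noncomputable def pone (L : Type) : CalcRr L := Finsupp.single ([], []) 1

/-- The derivative `∂/∂a` on `ℛ[r]`. -/
noncomputable def pderiv {L : Type} [DecidableEq L] (a : L) (X : CalcRr L) : CalcRr L :=
  X.sum fun p c => c •
    ((if p.1.getLast? = some a then Finsupp.single (p.1.dropLast, p.2) (1 : ℤ) else 0) -
     (if p.2.head? = some a then Finsupp.single (p.1, p.2.tail) (1 : ℤ) else 0))

/-- The embedding `ι : ℛ → ℛ[r]`, `ι(a₁,…,a_n) = Σ_k (a₁,…,a_k) ⊗ (a_{k+1},…,a_n)`. -/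
noncomputable def iotaR {L : Type} (C : CalcR L) : CalcRr L :=
  C.sum fun A c => c • (((List.range (A.length + 1)).map fun k =>
    Finsupp.single (A.take k, A.drop k) (1 : ℤ)).sum)

/-- The value at `0`: `(A⊗B)(0) = B` if `A = ∅` and `0` otherwise. -/
noncomputable def ev0 {L : Type} [DecidableEq L] (X : CalcRr L) : CalcR L :=
  X.sum fun p c => if p.1 = [] then Finsupp.single p.2 c else 0

/-- The value at `1`: `(A⊗B)(1) = A` if `B = ∅` and `0` otherwise. -/
noncomputable def ev1 {L : Type} [DecidableEq L] (X : CalcRr L) : CalcR L :=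
  X.sum fun p c => if p.2 = [] then Finsupp.single p.1 c else 0

/-- The integral `∫₀^# · da` on `ℛ[r]`. -/
noncomputable def integ0 {L : Type} (a : L) (X : CalcRr L) : CalcRr L :=
  X.sum fun p c => c • (((List.range (p.2.length + 1)).map fun k =>
    Finsupp.single (p.1 ++ a :: p.2.take k, p.2.drop k) (1 : ℤ)).sum)

/-- Iterated derivative `∂/∂a₁ ⋯ ∂/∂a_k` along a list `(a₁, …, a_k)`. -/
noncomputable def derivs {L : Type} [DecidableEq L] : List L → CalcRr L → CalcRr L
  | [], F => F
  | a :: w, F => pderiv a (derivs w F)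

theorem shuffles_nil_right {α : Type*} (xs : List α) : shuffles xs [] = [xs] := by
  cases xs <;> simp [shuffles]

theorem shuffles_ne_nil {α : Type*} (A B : List α) :
    ∀ s ∈ shuffles A B, (A ≠ [] ∨ B ≠ []) → s ≠ [] := by
  induction A, B using shuffles.induct with
  | case1 ys => simp [shuffles]
  | case2 x xs => simp [shuffles]
  | case3 x xs y ys ih1 ih2 =>
    intro s hs _
    simp only [shuffles, List.mem_append, List.mem_map] at hs
    rcases hs with ⟨t, _, rfl⟩ | ⟨t, _, rfl⟩ <;> simp

/-- Remove a leading `a`. -/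
def hdF {L M : Type} [DecidableEq L] [AddCommGroup M] (a : L) (g : List L → M) (s : List L) : M :=
  if s.head? = some a then g s.tail else 0

/-- Remove a trailing `a`. -/
def lsF {L M : Type} [DecidableEq L] [AddCommGroup M] (a : L) (g : List L → M) (s : List L) : M :=
  if s.getLast? = some a then g s.dropLast else 0

/-- Sum over shuffles. -/
def shS {L M : Type} [AddCommGroup M] (A B : List L) (g : List L → M) : M :=
  ((shuffles A B).map g).sum

theorem shS_nil_left {L M : Type} [AddCommGroup M] (B : List L) (g : List L → M) :
    shS [] B g = g B := by simp [shS, shuffles]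

theorem shS_nil_right {L M : Type} [AddCommGroup M] (B : List L) (g : List L → M) :
    shS B [] g = g B := by simp [shS, shuffles_nil_right]

theorem shS_cons {L M : Type} [AddCommGroup M] (x y : L) (A B : List L) (g : List L → M) :
    shS (x :: A) (y :: B) g =
      shS A (y :: B) (fun s => g (x :: s)) + shS (x :: A) B (fun s => g (y :: s)) := by
  simp [shS, shuffles, Function.comp_def]

theorem shS_zero {L M : Type} [AddCommGroup M] (A B : List L) :
    shS A B (fun _ => (0 : M)) = 0 := by simp [shS]

theorem shS_congr {L M : Type} [AddCommGroup M] (A B : List L) (f g : List L → M)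
    (h : ∀ s ∈ shuffles A B, f s = g s) : shS A B f = shS A B g := by
  unfold shS; rw [List.map_congr_left h]

theorem shS_add {L M : Type} [AddCommGroup M] (A B : List L) (f g : List L → M) :
    shS A B (fun s => f s + g s) = shS A B f + shS A B g := by
  simp [shS, List.sum_map_add]

theorem map_shS {L M N : Type} [AddCommGroup M] [AddCommGroup N] (φ : M →+ N)
    (A B : List L) (f : List L → M) : φ (shS A B f) = shS A B (fun s => φ (f s)) := by
  simp [shS, map_list_sum, Function.comp_def]

theorem shS_sub {L M : Type} [AddCommGroup M] (A B : List L) (f g : List L → M) :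
    shS A B (fun s => f s - g s) = shS A B f - shS A B g := by
  rw [eq_sub_iff_add_eq, ← shS_add]; simp

theorem shS_hd {L M : Type} [DecidableEq L] [AddCommGroup M] (a : L) (A B : List L)
    (g : List L → M) :
    shS A B (hdF a g) = hdF a (fun A' => shS A' B g) A + hdF a (fun B' => shS A B' g) B := by
  rcases A with _ | ⟨x, A⟩ <;> rcases B with _ | ⟨y, B⟩
  · simp [shS_nil_left, hdF]
  · simp [shS_nil_left, hdF]
  · simp [shS_nil_right, hdF]
  · rw [shS_cons]
    by_cases hx : x = a <;> by_cases hy : y = a <;> simp [hdF, hx, hy, shS_zero]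

theorem lsF_cons {L M : Type} [DecidableEq L] [AddCommGroup M] (a x : L) (g : List L → M)
    (s : List L) (hs : s ≠ []) : lsF a g (x :: s) = lsF a (fun t => g (x :: t)) s := by
  rcases s with _ | ⟨y, s⟩
  · exact absurd rfl hs
  · simp [lsF, List.getLast?_cons_cons]

theorem shS_ls {L M : Type} [DecidableEq L] [AddCommGroup M] (a : L) (A B : List L)
    (g : List L → M) :
    shS A B (lsF a g) = lsF a (fun A' => shS A' B g) A + lsF a (fun B' => shS A B' g) B := by
  induction A, B using shuffles.induct generalizing g with
  | case1 ys => simp [shS_nil_left, lsF]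
  | case2 x xs => simp [shS_nil_right, lsF]
  | case3 x xs y ys ih1 ih2 =>
    rw [shS_cons]
    rw [shS_congr xs (y :: ys) _ (lsF a (fun t => g (x :: t)))
      (fun s hs => lsF_cons a x g s (shuffles_ne_nil _ _ s hs (by simp)))]
    rw [shS_congr (x :: xs) ys _ (lsF a (fun t => g (y :: t)))
      (fun s hs => lsF_cons a y g s (shuffles_ne_nil _ _ s hs (by simp)))]
    rw [ih1, ih2]
    rcases xs with _ | ⟨x', xs⟩ <;> rcases ys with _ | ⟨y', ys⟩
    · simp [lsF, shS_nil_left, shS_nil_right]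
      abel
    · rw [lsF_cons a y _ (y' :: ys) (by simp)]
      simp only [lsF, shS_nil_left, shS_cons]
      by_cases h1 : x = a <;> by_cases h2 : (y' :: ys).getLast? = some a <;>
        simp [h1, h2, shS_nil_left, shS_cons, List.getLast?_cons_cons] <;> abel
    · rw [lsF_cons a x _ (x' :: xs) (by simp)]
      simp only [lsF, shS_nil_right, shS_cons]
      by_cases h1 : y = a <;> by_cases h2 : (x' :: xs).getLast? = some a <;>
        simp [h1, h2, shS_nil_right, shS_cons, List.getLast?_cons_cons] <;> abel
    · rw [lsF_cons a x _ (x' :: xs) (by simp), lsF_cons a y _ (y' :: ys) (by simp)]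
      rw [lsF_cons a x _ (x' :: xs) (by simp), lsF_cons a y _ (y' :: ys) (by simp)]
      simp only [lsF, shS_cons x y]
      split_ifs <;> abel

theorem pairBase_eq {L : Type} (p q : List L × List L) :
    pairBase p q = shS p.1 q.1 fun s => shS p.2 q.2 fun t => Finsupp.single (s, t) (1 : ℤ) := by
  unfold pairBase shS
  rw [List.flatMap, List.sum_flatten, List.map_map]
  rfl

/-- `pmul` as a bilinear map. -/
noncomputable def pmulL (L : Type) : CalcRr L →ₗ[ℤ] CalcRr L →ₗ[ℤ] CalcRr L :=
  Finsupp.linearCombination ℤ fun p => Finsupp.linearCombination ℤ fun q => pairBase p q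

theorem pmul_eq {L : Type} (X Y : CalcRr L) : pmul X Y = pmulL L X Y := by
  simp only [pmul, pmulL, Finsupp.linearCombination_apply, Finsupp.sum, LinearMap.sum_apply,
    LinearMap.smul_apply, Finset.smul_sum, mul_smul]

/-- The derivative of a basis element. -/
noncomputable def dB {L : Type} [DecidableEq L] (a : L) (p : List L × List L) : CalcRr L :=
  lsF a (fun s => Finsupp.single (s, p.2) (1 : ℤ)) p.1 -
    hdF a (fun t => Finsupp.single (p.1, t) (1 : ℤ)) p.2

/-- `pderiv` as a linear map. -/
noncomputable def pderivL {L : Type} [DecidableEq L] (a : L) : CalcRr L →ₗ[ℤ] CalcRr L :=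
  Finsupp.linearCombination ℤ (dB a)

theorem pderiv_eq {L : Type} [DecidableEq L] (a : L) (X : CalcRr L) :
    pderiv a X = pderivL a X := rfl

theorem pmulL_single {L : Type} (p q : List L × List L) :
    pmulL L (Finsupp.single p 1) (Finsupp.single q 1) = pairBase p q := by
  simp [pmulL]

theorem map_lsF {L M N : Type} [DecidableEq L] [AddCommGroup M] [AddCommGroup N] (φ : M →+ N)
    (a : L) (g : List L → M) (s : List L) : φ (lsF a g s) = lsF a (fun t => φ (g t)) s := by
  unfold lsF; split_ifs <;> simp

theorem map_hdF {L M N : Type} [DecidableEq L] [AddCommGroup M] [AddCommGroup N] (φ : M →+ N)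
    (a : L) (g : List L → M) (s : List L) : φ (hdF a g s) = hdF a (fun t => φ (g t)) s := by
  unfold hdF; split_ifs <;> simp

theorem shS_comm_ls {L M : Type} [DecidableEq L] [AddCommGroup M] (a : L) (A B : List L)
    (g : List L → List L → M) (s : List L) :
    shS A B (fun t => lsF a (fun s => g s t) s) = lsF a (fun s => shS A B (g s)) s := by
  unfold lsF; split_ifs <;> simp [shS_zero]

theorem shS_comm_hd {L M : Type} [DecidableEq L] [AddCommGroup M] (a : L) (A B : List L)
    (g : List L → List L → M) (s : List L) :
    shS A B (fun t => hdF a (fun s => g s t) s) = hdF a (fun s => shS A B (g s)) s := by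
  unfold hdF; split_ifs <;> simp [shS_zero]

theorem leibniz_base {L : Type} [DecidableEq L] (a : L) (p q : List L × List L) :
    pderivL a (pairBase p q) =
      pmulL L (dB a p) (Finsupp.single q 1) + pmulL L (Finsupp.single p 1) (dB a q) := by
  have h1 : pmulL L (dB a p) (Finsupp.single q 1) =
      lsF a (fun s => pairBase (s, p.2) q) p.1 - hdF a (fun t => pairBase (p.1, t) q) p.2 := by
    have e1 := map_lsF ((pmulL L).flip (Finsupp.single q 1)).toAddMonoidHom a
      (fun s => Finsupp.single (s, p.2) (1 : ℤ)) p.1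
    have e2 := map_hdF ((pmulL L).flip (Finsupp.single q 1)).toAddMonoidHom a
      (fun t => Finsupp.single (p.1, t) (1 : ℤ)) p.2
    simp only [LinearMap.toAddMonoidHom_coe, LinearMap.flip_apply, pmulL_single] at e1 e2
    rw [dB, map_sub, LinearMap.sub_apply, e1, e2]
  have h2 : pmulL L (Finsupp.single p 1) (dB a q) =
      lsF a (fun s => pairBase p (s, q.2)) q.1 - hdF a (fun t => pairBase p (q.1, t)) q.2 := by
    have e1 := map_lsF (pmulL L (Finsupp.single p 1)).toAddMonoidHom a
      (fun s => Finsupp.single (s, q.2) (1 : ℤ)) q.1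
    have e2 := map_hdF (pmulL L (Finsupp.single p 1)).toAddMonoidHom a
      (fun t => Finsupp.single (q.1, t) (1 : ℤ)) q.2
    simp only [LinearMap.toAddMonoidHom_coe, pmulL_single] at e1 e2
    rw [dB, map_sub, e1, e2]
  have h3 : pderivL a (pairBase p q) =
      shS p.1 q.1 fun s => shS p.2 q.2 fun t => dB a (s, t) := by
    rw [pairBase_eq]
    have := map_shS (pderivL a).toAddMonoidHom p.1 q.1
      (fun s => shS p.2 q.2 fun t => Finsupp.single (s, t) (1 : ℤ))
    rw [LinearMap.toAddMonoidHom_coe] at this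
    rw [this]
    refine shS_congr _ _ _ _ fun s _ => ?_
    have := map_shS (pderivL a).toAddMonoidHom p.2 q.2
      (fun t => Finsupp.single (s, t) (1 : ℤ))
    rw [LinearMap.toAddMonoidHom_coe] at this
    rw [this]
    simp [pderivL]
  rw [h1, h2, h3]
  simp only [dB, shS_sub, pairBase_eq]
  simp only [shS_comm_ls a p.2 q.2 (fun s t => Finsupp.single (s, t) (1 : ℤ))]
  have h4 := shS_ls a p.1 q.1 (fun s => shS p.2 q.2 fun t => Finsupp.single (s, t) (1 : ℤ))
  have h5 : (shS p.1 q.1 fun s => shS p.2 q.2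
      (hdF a fun t => (Finsupp.single (s, t) (1 : ℤ) : CalcRr L))) =
      hdF a (fun A' => shS p.1 q.1 fun s => shS A' q.2 fun t => Finsupp.single (s, t) (1 : ℤ)) p.2 +
      hdF a (fun B' => shS p.1 q.1 fun s => shS p.2 B' fun t => Finsupp.single (s, t) (1 : ℤ)) q.2
      := by
    simp only [shS_hd, shS_add]
    rw [shS_comm_hd a p.1 q.1 (fun A' s => shS A' q.2 fun t => Finsupp.single (s, t) (1 : ℤ)),
      shS_comm_hd a p.1 q.1 (fun B' s => shS p.2 B' fun t => Finsupp.single (s, t) (1 : ℤ))]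
  change shS p.1 q.1 (lsF a _) - (shS p.1 q.1 fun s => shS p.2 q.2
      (hdF a fun t => (Finsupp.single (s, t) (1 : ℤ) : CalcRr L))) = _
  rw [h4, h5]
  abel

/-- Leibniz rule: `∂/∂a (X₁ X₂) = (∂/∂a X₁) X₂ + X₁ (∂/∂a X₂)` in `ℛ[r]`. -/
theorem leibniz_rule (L : Type) [DecidableEq L] (X₁ X₂ : CalcRr L) (a : L) :
    pderiv a (pmul X₁ X₂) = pmul (pderiv a X₁) X₂ + pmul X₁ (pderiv a X₂) := by
  simp only [pmul_eq, pderiv_eq]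
  have key : (pmulL L).compr₂ (pderivL a) =
      (pmulL L).comp (pderivL a) + (pmulL L).compl₂ (pderivL a) := by
    refine Finsupp.lhom_ext' fun p => LinearMap.ext_ring ?_
    refine Finsupp.lhom_ext' fun q => LinearMap.ext_ring ?_
    have := leibniz_base a p q
    simpa [pmulL_single, pderivL] using this
  have := LinearMap.congr_fun (LinearMap.congr_fun key X₁) X₂
  simpa using this
end

section
/- For every C ∈ ℛ the element ι(C) ∈ ℛ[r] is a constant function, in the sense that ∂/∂a ι(C) = 0 for every a ∈ L. -/
/-- The derivative of a basis element. -/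
noncomputable def pderivBase {L : Type} [DecidableEq L] (a : L) (p : List L × List L) : CalcRr L :=
  (if p.1.getLast? = some a then Finsupp.single (p.1.dropLast, p.2) (1 : ℤ) else 0) -
     (if p.2.head? = some a then Finsupp.single (p.1, p.2.tail) (1 : ℤ) else 0)

theorem pderiv_eq_lin {L : Type} [DecidableEq L] (a : L) (X : CalcRr L) :
    pderiv a X = Finsupp.linearCombination ℤ (pderivBase a) X := rfl

theorem pderivBase_sum {L : Type} [DecidableEq L] (a : L) (A : List L) :
    ∑ k ∈ Finset.range (A.length + 1), pderivBase a (A.take k, A.drop k) = 0 := by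
  unfold pderivBase
  rw [Finset.sum_sub_distrib, Finset.sum_range_succ', Finset.sum_range_succ]
  simp only [List.take_zero, List.getLast?_nil, List.drop_length, List.head?_nil,
    reduceCtorEq, if_false, add_zero]
  rw [sub_eq_zero]
  refine Finset.sum_congr rfl fun k hk => ?_
  have hk : k < A.length := Finset.mem_range.mp hk
  have h1 : A.take (k + 1) = A.take k ++ [A[k]] := by simp
  have h2 : A.drop k = A[k] :: A.drop (k + 1) := List.drop_eq_getElem_cons hk
  have e1 : (A.take (k + 1)).getLast? = some A[k] := by rw [h1, List.getLast?_concat]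
  have e2 : (A.take (k + 1)).dropLast = A.take k := by rw [h1, List.dropLast_concat]
  have e3 : (A.drop k).head? = some A[k] := by rw [h2, List.head?_cons]
  have e4 : (A.drop k).tail = A.drop (k + 1) := by rw [h2, List.tail_cons]
  rw [e1, e2, e3, e4]

/-- every `ι(C)` is a constant function: `∂/∂a ι(C) = 0` for every `a ∈ L`. -/
theorem iota_constant (L : Type) [DecidableEq L] (C : CalcR L) (a : L) :
    pderiv a (iotaR C) = 0 := by
  rw [pderiv_eq_lin]
  unfold iotaR
  rw [Finsupp.sum, map_sum]
  refine Finset.sum_eq_zero fun A _ => ?_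
  rw [map_smul, map_list_sum, List.map_map]
  have h : ((List.range (A.length + 1)).map
      (Finsupp.linearCombination ℤ (pderivBase a) ∘ fun k =>
        Finsupp.single (A.take k, A.drop k) (1 : ℤ))).sum
      = ∑ k ∈ Finset.range (A.length + 1), pderivBase a (A.take k, A.drop k) := by
    rw [← List.sum_toFinset _ List.nodup_range, List.toFinset_range]
    refine Finset.sum_congr rfl fun k _ => ?_
    simp
  rw [h, pderivBase_sum, smul_zero]
end

section
/- (Fundamental theorem of combinatorial calculus) For every F ∈ ℛ[r] one has F = ι[F(0)] + Σ_{a ∈ L} ∫₀^# (∂/∂a F) da, where only finitely many summands are nonzero. -/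
theorem pderiv_add' {L : Type} [DecidableEq L] (a : L) (X Y : CalcRr L) :
    pderiv a (X + Y) = pderiv a X + pderiv a Y := by
  unfold pderiv
  exact Finsupp.sum_add_index' (fun p => zero_smul _ _) (fun p c d => add_smul c d _)

theorem integ0_add' {L : Type} (a : L) (X Y : CalcRr L) :
    integ0 a (X + Y) = integ0 a X + integ0 a Y := by
  unfold integ0
  exact Finsupp.sum_add_index' (fun p => zero_smul _ _) (fun p c d => add_smul c d _)

theorem iotaR_add' {L : Type} (X Y : CalcR L) :
    iotaR (X + Y) = iotaR X + iotaR Y := by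
  unfold iotaR
  exact Finsupp.sum_add_index' (fun p => zero_smul _ _) (fun p c d => add_smul c d _)

theorem ev0_add' {L : Type} [DecidableEq L] (X Y : CalcRr L) :
    ev0 (X + Y) = ev0 X + ev0 Y := by
  unfold ev0
  refine Finsupp.sum_add_index' (fun p => by simp) (fun p c d => ?_)
  split_ifs <;> simp

/-- Sum over all ways to move an initial segment of `B` to the end of `A`. -/
noncomputable def slide {L : Type} (A B : List L) : CalcRr L :=
  ((List.range (B.length + 1)).map fun k =>
    Finsupp.single (A ++ B.take k, B.drop k) (1 : ℤ)).sum

theorem slide_nil {L : Type} (A : List L) : slide A [] = Finsupp.single (A, []) (1 : ℤ) := by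
  simp [slide]

theorem slide_cons {L : Type} (A B : List L) (b : L) :
    slide A (b :: B) = Finsupp.single (A, b :: B) (1 : ℤ) + slide (A ++ [b]) B := by
  unfold slide
  rw [List.length_cons, List.range_succ_eq_map, List.map_cons, List.sum_cons, List.map_map]
  simp [Function.comp_def]

theorem integ0_single' {L : Type} (a : L) (A B : List L) (c : ℤ) :
    integ0 a (Finsupp.single (A, B) c) = c • slide (A ++ [a]) B := by
  unfold integ0
  rw [Finsupp.sum_single_index (by simp)]
  simp [slide]

theorem iotaR_single' {L : Type} (B : List L) (c : ℤ) :
    iotaR (Finsupp.single B c) = c • slide [] B := by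
  unfold iotaR
  rw [Finsupp.sum_single_index (by simp)]
  simp [slide]

theorem integ0_zero' {L : Type} (a : L) : integ0 a (0 : CalcRr L) = 0 := by
  simp [integ0]

theorem iotaR_zero' {L : Type} : iotaR (0 : CalcR L) = 0 := by
  simp [iotaR]

theorem integ0_sub' {L : Type} (a : L) (X Y : CalcRr L) :
    integ0 a (X - Y) = integ0 a X - integ0 a Y := by
  rw [eq_sub_iff_add_eq, ← integ0_add', sub_add_cancel]

/-- The part of `∫₀^# ∂/∂a` coming from the last element of `A`. -/
noncomputable def partLast {L : Type} [DecidableEq L] (A B : List L) (c : ℤ) (a : L) :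
    CalcRr L :=
  if A.getLast? = some a then c • slide A B else 0

/-- The part of `∫₀^# ∂/∂a` coming from the first element of `B`. -/
noncomputable def partHead {L : Type} [DecidableEq L] (A B : List L) (c : ℤ) (a : L) :
    CalcRr L :=
  if B.head? = some a then c • slide (A ++ [a]) B.tail else 0

theorem integ0_pderiv_single {L : Type} [DecidableEq L] (A B : List L) (c : ℤ) (a : L) :
    integ0 a (pderiv a (Finsupp.single (A, B) c)) = partLast A B c a - partHead A B c a := by
  unfold pderiv partLast partHead
  rw [Finsupp.sum_single_index (by simp), smul_sub, integ0_sub']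
  congr 1
  · split_ifs with h
    · have h2 : A.dropLast ++ [a] = A := List.dropLast_append_getLast? a h
      simp only [Finsupp.smul_single, smul_eq_mul, mul_one]
      rw [integ0_single', h2]
    · rw [smul_zero, integ0_zero']
  · split_ifs with h
    · simp only [Finsupp.smul_single, smul_eq_mul, mul_one]
      rw [integ0_single']
    · rw [smul_zero, integ0_zero']

theorem finite_option_support {L M : Type} [DecidableEq L] [Zero M] (o : Option L) (f : L → M) :
    (Function.support fun a => if o = some a then f a else 0).Finite := by
  cases o with
  | none => simp
  | some x =>
    refine (Set.finite_singleton x).subset fun a ha => ?_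
    by_contra h
    apply ha
    have : x ≠ a := fun e => h (by simp [e])
    simp [this]

theorem finsum_option_some {L M : Type} [DecidableEq L] [AddCommMonoid M] (o : Option L) (x : L)
    (ho : o = some x) (f : L → M) : (∑ᶠ a, if o = some a then f a else 0) = f x := by
  subst ho
  rw [finsum_eq_single _ x]
  · simp
  · intro a ha
    simp [ha.symm]

theorem finite_partLast {L : Type} [DecidableEq L] (A B : List L) (c : ℤ) :
    (Function.support (partLast A B c)).Finite :=
  finite_option_support A.getLast? fun _ => c • slide A B

theorem finite_partHead {L : Type} [DecidableEq L] (A B : List L) (c : ℤ) :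
    (Function.support (partHead A B c)).Finite :=
  finite_option_support B.head? fun a => c • slide (A ++ [a]) B.tail

theorem sum_partLast {L : Type} [DecidableEq L] (A B : List L) (c : ℤ) :
    iotaR (ev0 (Finsupp.single (A, B) c)) + ∑ᶠ a, partLast A B c a = c • slide A B := by
  have he : ev0 (Finsupp.single (A, B) c) = if A = [] then Finsupp.single B c else 0 := by
    unfold ev0
    rw [Finsupp.sum_single_index (by simp)]
  rw [he]
  unfold partLast
  rcases List.eq_nil_or_concat A with rfl | ⟨A', x, rfl⟩
  · simp [iotaR_single']
  · rw [finsum_option_some _ x (by simp) fun _ => c • slide (A'.concat x) B]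
    simp [iotaR_zero']

theorem sum_partHead {L : Type} [DecidableEq L] (A B : List L) (c : ℤ) :
    Finsupp.single (A, B) c + ∑ᶠ a, partHead A B c a = c • slide A B := by
  unfold partHead
  cases B with
  | nil => simp [slide_nil]
  | cons b B =>
    rw [finsum_option_some _ b (by simp) fun a => c • slide (A ++ [a]) (b :: B).tail, slide_cons, smul_add]
    simp

/-- Finiteness of the sum together with the fundamental theorem. -/
theorem fundamental_aux (L : Type) [DecidableEq L] (F : CalcRr L) :
    (Function.support fun a : L => integ0 a (pderiv a F)).Finite ∧
    F = iotaR (ev0 F) + ∑ᶠ a : L, integ0 a (pderiv a F) := by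
  induction F using Finsupp.induction_linear with
  | zero => simp [pderiv, integ0, iotaR, ev0]
  | add X Y hX hY =>
    simp only [pderiv_add', integ0_add', iotaR_add', ev0_add']
    refine ⟨(hX.1.union hY.1).subset (Function.support_add _ _), ?_⟩
    rw [finsum_add_distrib hX.1 hY.1, add_add_add_comm, ← hX.2, ← hY.2]
  | single p c =>
    obtain ⟨A, B⟩ := p
    simp only [integ0_pderiv_single]
    refine ⟨((finite_partLast A B c).union (finite_partHead A B c)).subset
      (Function.support_sub _ _), ?_⟩
    rw [finsum_sub_distrib (finite_partLast A B c) (finite_partHead A B c), ← add_sub_assoc,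
      sum_partLast, eq_sub_iff_add_eq, sum_partHead]

/-- Fundamental theorem of combinatorial calculus:
`F = ι[F(0)] + Σ_{a ∈ L} ∫₀^# (∂/∂a F) da`, the (finitely supported) sum running over all
labels. -/
theorem fundamental_theorem (L : Type) [DecidableEq L] (F : CalcRr L) :
    F = iotaR (ev0 F) + ∑ᶠ a : L, integ0 a (pderiv a F) := by
  exact (fundamental_aux L F).2
end

section
/- Let X, Y ∈ ℛ[r] and a ∈ L. If Y(0) = 0, ∂/∂a Y = X, and ∂/∂a′ Y = 0 for every a′ ∈ L with a′ ≠ a, then Y = ∫₀^# X da. -/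
/-- Coefficient of the integral of a basis element. -/
def kcoef {L : Type} [DecidableEq L] (a : L) (p q : List L × List L) : ℤ :=
  ((List.range (p.2.length + 1)).map fun k =>
    if (p.1 ++ a :: p.2.take k, p.2.drop k) = q then (1 : ℤ) else 0).sum

theorem list_sum_apply {α : Type*} (l : List (α →₀ ℤ)) (q : α) :
    l.sum q = (l.map fun f => f q).sum := by
  induction l with
  | nil => simp
  | cons x l ih => simp [ih]

theorem integ0_apply {L : Type} [DecidableEq L] (a : L) (X : CalcRr L) (q : List L × List L) :
    integ0 a X q = X.sum fun p c => c * kcoef a p q := by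
  unfold integ0
  rw [Finsupp.sum_apply]
  refine Finsupp.sum_congr fun p _ => ?_
  rw [Finsupp.smul_apply, list_sum_apply, smul_eq_mul, List.map_map, kcoef]
  congr 3
  funext k
  simp [Finsupp.single_apply]

theorem kcoef_nil {L : Type} [DecidableEq L] (a : L) (p : List L × List L) (B : List L) :
    kcoef a p ([], B) = 0 := by
  simp [kcoef]

theorem kcoef_rec {L : Type} [DecidableEq L] (a c : L) (p : List L × List L) (A B : List L) :
    kcoef a p (A ++ [c], B) =
      kcoef a p (A, c :: B) + if c = a then (if p = (A, B) then 1 else 0) else 0 := by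
  obtain ⟨P, Q⟩ := p
  unfold kcoef
  simp only
  conv_lhs => rw [List.range_succ_eq_map]
  conv_rhs => rw [List.range_succ]
  simp only [List.map_cons, List.sum_cons, List.map_append, List.sum_append, List.map_map,
    List.map_nil, List.sum_nil]
  have e1 : (if (P ++ a :: List.take 0 Q, List.drop 0 Q) = (A ++ [c], B) then (1 : ℤ) else 0)
      = if c = a then (if (P, Q) = (A, B) then 1 else 0) else 0 := by
    have : (P ++ [a] = A ++ [c]) ↔ (P = A ∧ a = c) := by
      simp [List.append_eq_append_iff_of_size_eq_right]
    simp only [List.take_zero, List.drop_zero, Prod.mk.injEq, this]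
    split_ifs <;> grind
  have e2 : (if (P ++ a :: List.take Q.length Q, List.drop Q.length Q) = (A, c :: B)
      then (1 : ℤ) else 0) = 0 := by simp
  rw [e1, e2]
  have e3 : List.map ((fun k => if (P ++ a :: List.take k Q, List.drop k Q) = (A ++ [c], B)
        then (1 : ℤ) else 0) ∘ Nat.succ) (List.range Q.length) =
      List.map (fun k => if (P ++ a :: List.take k Q, List.drop k Q) = (A, c :: B)
        then (1 : ℤ) else 0) (List.range Q.length) := by
    refine List.map_congr_left fun j hj => ?_
    have hj : j < Q.length := by simpa using hj
    have t : P ++ a :: List.take (j + 1) Q = (P ++ a :: List.take j Q) ++ [Q[j]] := by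
      simp
    have d : List.drop j Q = Q[j] :: List.drop (j + 1) Q := List.drop_eq_getElem_cons hj
    simp only [Function.comp, Nat.succ_eq_add_one]
    rw [t, d]
    congr 1
    have : ∀ S : List L, ∀ x : L, (S ++ [x] = A ++ [c]) ↔ (S = A ∧ x = c) := by
      intro S x
      simp
    simp only [Prod.mk.injEq, this, List.cons.injEq, and_assoc]
  rw [e3]
  ring

theorem integ0_rec {L : Type} [DecidableEq L] (a c : L) (X : CalcRr L) (A B : List L) :
    integ0 a X (A ++ [c], B) = integ0 a X (A, c :: B) + if c = a then X (A, B) else 0 := by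
  simp only [integ0_apply, kcoef_rec, mul_add]
  rw [Finsupp.sum_add]
  congr 1
  split_ifs
  · simp [Finsupp.sum] <;> tauto
  · simp

theorem pderiv_apply {L : Type} [DecidableEq L] (c : L) (Y : CalcRr L) (A B : List L) :
    pderiv c Y (A, B) = Y (A ++ [c], B) - Y (A, c :: B) := by
  have key : ∀ q : List L × List L, Y q = Y.sum fun p d => d * if p = q then 1 else 0 := by
    intro q
    simp [Finsupp.sum] <;> tauto
  unfold pderiv
  rw [Finsupp.sum_apply, key (A ++ [c], B), key (A, c :: B), ← Finsupp.sum_sub]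
  refine Finsupp.sum_congr fun p _ => ?_
  obtain ⟨P, Q⟩ := p
  rw [Finsupp.smul_apply, smul_eq_mul, ← mul_sub, Finsupp.sub_apply]
  congr 2
  · rcases List.eq_nil_or_concat P with rfl | ⟨S, x, rfl⟩
    · simp
    · by_cases h : x = c <;> simp [h, Finsupp.single_apply]
  · rcases Q with _ | ⟨x, Q⟩
    · simp
    · by_cases h : x = c <;> simp [h, Finsupp.single_apply]

theorem ev0_apply {L : Type} [DecidableEq L] (Y : CalcRr L) (B : List L) :
    ev0 Y B = Y ([], B) := by
  have key : ∀ q : List L × List L, Y q = Y.sum fun p d => if p = q then d else 0 := by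
    intro q
    simp [Finsupp.sum] <;> tauto
  unfold ev0
  rw [Finsupp.sum_apply, key]
  refine Finsupp.sum_congr fun p _ => ?_
  obtain ⟨P, Q⟩ := p
  by_cases h : P = [] <;> simp [h, Finsupp.single_apply]

/-- if `Y(0) = 0`, `∂/∂a Y = X` and `∂/∂a' Y = 0` for every `a' ≠ a`,
then `Y = ∫₀^# X da`. -/
theorem integral_characterization (L : Type) [DecidableEq L] (X Y : CalcRr L) (a : L)
    (h0 : ev0 Y = 0) (ha : pderiv a Y = X) (h' : ∀ a' : L, a' ≠ a → pderiv a' Y = 0) :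
    Y = integ0 a X := by
  have main : ∀ A B : List L, Y (A, B) = integ0 a X (A, B) := by
    intro A
    induction A using List.reverseRecOn with
    | nil =>
      intro B
      rw [← ev0_apply, h0, integ0_apply]
      simp [kcoef_nil]
    | append_singleton A c ih =>
      intro B
      have hd := pderiv_apply c Y A B
      rw [integ0_rec, ← ih]
      by_cases hc : c = a
      · subst hc
        rw [ha] at hd
        simp [hd]
      · rw [h' c hc] at hd
        simp only [Finsupp.coe_zero, Pi.zero_apply] at hd
        simp only [hc, if_false]
        linarith
  ext ⟨A, B⟩
  exact main A B
end
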